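/- Let ν be a Lévy measure on (0,∞) with ∫ min(x,1) ν(dx) < ∞ and let Φ(t) = ∫ (1 - exp(-t(1-e^{-x}))) ν(dx). If φ(t) := Φ(e^t) is slowly varying at infinity in the sense of de Haan's class Γ with auxiliary function h (i.e., φ(t - u h(t))/φ(t) → e^{-u} for all real u, and h(t) → ∞), then one may take h(t) = ∫₀ᵗ φ(y) dy / φ(t), and with this choice E[η_t] := ∫₀^∞ φ(t - y h(t))/φ(t) dy → 1 as t → ∞. -/

import Mathlib

open MeasureTheory Filter

lemma dh_phi_top (φ : ℝ → ℝ) (hpos : ∀ t, 0 < φ t) (hm : Monotone φ)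
    (g : ℝ → ℝ) (gpos : ∀ t, 0 < g t)
    (hΓ : ∀ u : ℝ, Tendsto (fun t => φ (t - u * g t) / φ t) atTop (nhds (Real.exp (-u)))) :
    Tendsto φ atTop atTop := by
  rcases tendsto_atTop_of_monotone hm with h | ⟨l, hl⟩
  · exact h
  · exfalso
    have hl0 : 0 < l := lt_of_lt_of_le (hpos 0) (hm.ge_of_tendsto hl 0)
    have h1 : Tendsto (fun t => t - (-1) * g t) atTop atTop := by
      refine tendsto_atTop_mono (fun t => ?_) tendsto_id
      have := gpos t
      simp only [id]; linarith
    have h2 : Tendsto (fun t => φ (t - (-1) * g t) / φ t) atTop (nhds (l / l)) :=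
      (hl.comp h1).div hl hl0.ne'
    have h3 := tendsto_nhds_unique h2 (hΓ (-1))
    rw [div_self hl0.ne', neg_neg] at h3
    have := Real.add_one_lt_exp (one_ne_zero (α := ℝ))
    linarith

lemma dh_shift_top (φ : ℝ → ℝ) (hpos : ∀ t, 0 < φ t) (hm : Monotone φ)
    (g : ℝ → ℝ)
    (hΓ : ∀ u : ℝ, Tendsto (fun t => φ (t - u * g t) / φ t) atTop (nhds (Real.exp (-u))))
    (htop : Tendsto φ atTop atTop) (u : ℝ) :
    Tendsto (fun t => t - u * g t) atTop atTop := by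
  have h1 : Tendsto (fun t => φ (t - u * g t)) atTop atTop := by
    have := (hΓ u).pos_mul_atTop (Real.exp_pos _) htop
    refine this.congr (fun t => ?_)
    field_simp [(hpos t).ne']
  rw [tendsto_atTop]
  intro b
  filter_upwards [h1.eventually_gt_atTop (φ b)] with t ht
  by_contra hc
  push Not at hc
  exact absurd (hm hc.le) (not_le.mpr ht)

lemma dh_g_le (φ : ℝ → ℝ) (hpos : ∀ t, 0 < φ t) (hm : Monotone φ)
    (g : ℝ → ℝ)
    (hΓ : ∀ u : ℝ, Tendsto (fun t => φ (t - u * g t) / φ t) atTop (nhds (Real.exp (-u))))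
    (htop : Tendsto φ atTop atTop) (u : ℝ) :
    ∀ᶠ t in atTop, g (t - u * g t) ≤ 2 * g t := by
  have hs := dh_shift_top φ hpos hm g hΓ htop u
  have h1 := ((hΓ 1).comp hs).mul (hΓ u)
  have h2 := hΓ (u + 2)
  have hlt : Real.exp (-(u + 2)) < Real.exp (-1) * Real.exp (-u) := by
    rw [← Real.exp_add]; apply Real.exp_lt_exp.mpr; linarith
  filter_upwards [h2.eventually_lt h1 hlt] with t ht
  by_contra hc
  push Not at hc
  simp only [Function.comp] at ht
  set s := t - u * g t with hsdef
  rw [div_mul_div_cancel₀ (hpos s).ne', div_lt_div_iff_of_pos_right (hpos t)] at ht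
  exact absurd (hm (show s - 1 * g s ≤ t - (u + 2) * g t by rw [hsdef] at *; linarith))
    (not_le.mpr ht)

lemma dh_step (φ : ℝ → ℝ) (hm : Monotone φ) (a b : ℝ) (hab : a ≤ b) :
    (∫ y in (0:ℝ)..b, φ y) ≤ (∫ y in (0:ℝ)..a, φ y) + (b - a) * φ b := by
  have h1 := intervalIntegral.integral_add_adjacent_intervals
    (hm.intervalIntegrable (μ := volume) (a := 0) (b := a))
    (hm.intervalIntegrable (μ := volume) (a := a) (b := b))
  have h2 : (∫ y in a..b, φ y) ≤ ∫ y in a..b, φ b :=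
    intervalIntegral.integral_mono_on hab hm.intervalIntegrable intervalIntegrable_const
      (fun x hx => hm hx.2)
  rw [intervalIntegral.integral_const, smul_eq_mul] at h2
  linarith

lemma dh_K_mono (φ : ℝ → ℝ) (hpos : ∀ t, 0 < φ t) (hm : Monotone φ) :
    Monotone (fun t => ∫ y in (0:ℝ)..t, φ y) := by
  intro a b hab
  have h1 := intervalIntegral.integral_add_adjacent_intervals
    (hm.intervalIntegrable (μ := volume) (a := 0) (b := a))
    (hm.intervalIntegrable (μ := volume) (a := a) (b := b))
  have h2 : 0 ≤ ∫ y in a..b, φ y :=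
    intervalIntegral.integral_nonneg hab (fun x _ => (hpos x).le)
  simp only
  linarith

lemma dh_bound (φ : ℝ → ℝ) (hpos : ∀ t, 0 < φ t) (hm : Monotone φ)
    (g : ℝ → ℝ)
    (hΓ : ∀ u : ℝ, Tendsto (fun t => φ (t - u * g t) / φ t) atTop (nhds (Real.exp (-u))))
    (ginf : Tendsto g atTop atTop)
    (htop : Tendsto φ atTop atTop) :
    ∃ M, 0 < M ∧ ∀ᶠ t in atTop, (∫ y in (0:ℝ)..t, φ y) ≤ M * (g t * φ t) := by
  have he : Real.exp (-1) < 0.4 := by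
    have := Real.exp_neg_one_lt_d9; linarith
  obtain ⟨T, hT⟩ := eventually_atTop.mp ((dh_g_le φ hpos hm g hΓ htop 1).and
    (((hΓ 1).eventually_lt_const he).and (ginf.eventually_ge_atTop 1)))
  set K : ℝ → ℝ := fun t => ∫ y in (0:ℝ)..t, φ y with hK
  set c := φ T with hc
  have hcpos : 0 < c := hpos T
  refine ⟨5 + |K T| / c, by positivity, eventually_atTop.mpr ⟨T, ?_⟩⟩
  have key : ∀ n : ℕ, ∀ t, T ≤ t → t < T + n → K t ≤ (5 + |K T| / c) * (g t * φ t) := by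
    intro n
    induction n with
    | zero => intro t h1 h2; simp at h2; linarith
    | succ n ih =>
      intro t h1 h2
      obtain ⟨ha, hb, hg⟩ := hT t h1
      rw [one_mul] at ha hb
      rw [div_lt_iff₀ (hpos t)] at hb
      have hst := dh_step φ hm (t - g t) t (by linarith)
      have hst' : K t ≤ K (t - g t) + g t * φ t := by
        simpa [hK] using hst
      have hp : 0 < g t * φ t := mul_pos (by linarith) (hpos t)
      by_cases hlt : t - g t < T
      · have h3 : K (t - g t) ≤ K T := dh_K_mono φ hpos hm hlt.le
        have h4 : c ≤ g t * φ t := by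
          have : c ≤ φ t := hm h1
          nlinarith
        have h5 : |K T| ≤ |K T| / c * (g t * φ t) := by
          calc |K T| = |K T| / c * c := by field_simp
            _ ≤ _ := by gcongr
        have := le_abs_self (K T)
        nlinarith
      · push Not at hlt
        have h3 := ih (t - g t) hlt (by push_cast at h2; linarith)
        have h4 : g (t - g t) * φ (t - g t) ≤ 2 * g t * (0.4 * φ t) := by
          have := hpos (t - g t)
          exact mul_le_mul ha hb.le this.le (by linarith)
        have hA : 0 ≤ |K T| / c := by positivity
        have h5 : (5 + |K T| / c) * (g (t - g t) * φ (t - g t))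
            ≤ (5 + |K T| / c) * (2 * g t * (0.4 * φ t)) := by gcongr
        have h6 : 0 ≤ |K T| / c * (g t * φ t) := by positivity
        nlinarith
  intro t ht
  obtain ⟨n, hn⟩ := exists_nat_gt (t - T)
  exact key n t ht (by linarith)

lemma dh_trunc (φ : ℝ → ℝ) (hpos : ∀ t, 0 < φ t) (hm : Monotone φ)
    (g : ℝ → ℝ) (gpos : ∀ t, 0 < g t)
    (hΓ : ∀ u : ℝ, Tendsto (fun t => φ (t - u * g t) / φ t) atTop (nhds (Real.exp (-u))))
    (N : ℝ) (hN : 0 ≤ N) :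
    Tendsto (fun t => ((∫ y in (0:ℝ)..t, φ y) - ∫ y in (0:ℝ)..(t - N * g t), φ y) / (g t * φ t))
      atTop (nhds (1 - Real.exp (-N))) := by
  have h1 : Tendsto (fun t => ∫ y in (0:ℝ)..N, φ (t - y * g t) / φ t) atTop
      (nhds (∫ y in (0:ℝ)..N, Real.exp (-y))) := by
    refine intervalIntegral.tendsto_integral_filter_of_dominated_convergence (fun _ => 1)
      ?_ ?_ intervalIntegrable_const ?_
    · refine Eventually.of_forall (fun t => ?_)
      have : Measurable (fun y => φ (t - y * g t) / φ t) :=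
        (hm.measurable.comp (by fun_prop)).div_const _
      exact this.aestronglyMeasurable
    · refine Eventually.of_forall (fun t => Eventually.of_forall (fun y hy => ?_))
      rw [Set.uIoc_of_le hN] at hy
      rw [Real.norm_of_nonneg (div_nonneg (hpos _).le (hpos _).le), div_le_one (hpos t)]
      apply hm
      have := mul_pos hy.1 (gpos t)
      linarith
    · exact Eventually.of_forall (fun y _ => hΓ y)
  have h2 : (∫ y in (0:ℝ)..N, Real.exp (-y)) = 1 - Real.exp (-N) := by
    rw [intervalIntegral.integral_comp_neg (fun x => Real.exp x), integral_exp]; simp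
  rw [h2] at h1
  refine h1.congr (fun t => ?_)
  rw [intervalIntegral.integral_div]
  have h3 : (∫ y in (0:ℝ)..N, φ (t - y * g t)) = (g t)⁻¹ * ∫ y in (t - N * g t)..t, φ y := by
    have h4 := intervalIntegral.integral_comp_sub_mul (a := 0) (b := N) φ (gpos t).ne' t
    simp only [mul_comm (g t), zero_mul, sub_zero, smul_eq_mul] at h4
    simpa [mul_comm] using h4
  have h5 := intervalIntegral.integral_add_adjacent_intervals
    (hm.intervalIntegrable (μ := volume) (a := 0) (b := t - N * g t))
    (hm.intervalIntegrable (μ := volume) (a := t - N * g t) (b := t))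
  rw [h3, ← h5]
  have := gpos t
  have := hpos t
  field_simp
  ring

lemma dh_q (φ : ℝ → ℝ) (hpos : ∀ t, 0 < φ t) (hm : Monotone φ)
    (g : ℝ → ℝ) (gpos : ∀ t, 0 < g t)
    (hΓ : ∀ u : ℝ, Tendsto (fun t => φ (t - u * g t) / φ t) atTop (nhds (Real.exp (-u))))
    (ginf : Tendsto g atTop atTop)
    (htop : Tendsto φ atTop atTop) :
    Tendsto (fun t => (∫ y in (0:ℝ)..t, φ y) / (g t * φ t)) atTop (nhds 1) := by
  obtain ⟨M, hM, hb⟩ := dh_bound φ hpos hm g hΓ ginf htop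
  rw [Metric.tendsto_atTop']
  suffices H : ∀ ε > 0, ∀ᶠ t in atTop,
      dist ((∫ y in (0:ℝ)..t, φ y) / (g t * φ t)) 1 < ε by
    intro ε hε
    obtain ⟨a, ha⟩ := eventually_atTop.mp (H ε hε)
    exact ⟨a, fun n hn => ha n hn.le⟩
  intro ε hε
  have hexp : Tendsto (fun N : ℝ => Real.exp (-N)) atTop (nhds 0) :=
    Real.tendsto_exp_neg_atTop_nhds_zero
  obtain ⟨N, hN1, hN0⟩ := ((hexp.eventually_lt_const
    (show (0:ℝ) < ε / (8 * M + 8) by positivity)).and (eventually_ge_atTop 0)).exists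
  have hs := dh_shift_top φ hpos hm g hΓ htop N
  have ht := dh_trunc φ hpos hm g gpos hΓ N hN0
  have he := Real.exp_pos (-N)
  rw [lt_div_iff₀ (by positivity)] at hN1
  have hMe : 0 < Real.exp (-N) * M := by positivity
  filter_upwards [hs.eventually hb, hs.eventually_ge_atTop 0, dh_g_le φ hpos hm g hΓ htop N,
    (hΓ N).eventually_lt_const (show Real.exp (-N) < 2 * Real.exp (-N) by linarith),
    ht.eventually_lt_const (show 1 - Real.exp (-N) < 1 - Real.exp (-N) + ε / 4 by linarith),
    ht.eventually_const_lt (show 1 - Real.exp (-N) - ε / 4 < 1 - Real.exp (-N) by linarith)]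
    with t h1 h2 h3 h4 h5 h6
  set s := t - N * g t with hsdef
  have hp : 0 < g t * φ t := mul_pos (gpos t) (hpos t)
  rw [sub_div] at h5 h6
  have h7 : 0 ≤ (∫ y in (0:ℝ)..s, φ y) / (g t * φ t) :=
    div_nonneg (intervalIntegral.integral_nonneg h2 (fun x _ => (hpos x).le)) hp.le
  have h8 : (∫ y in (0:ℝ)..s, φ y) / (g t * φ t) ≤ 4 * (Real.exp (-N) * M) := by
    rw [div_le_iff₀ hp]
    rw [div_lt_iff₀ (hpos t)] at h4
    have : g s * φ s ≤ 2 * g t * (2 * Real.exp (-N) * φ t) :=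
      mul_le_mul h3 h4.le (hpos s).le (by have := gpos t; linarith)
    calc _ ≤ M * (g s * φ s) := h1
      _ ≤ M * (2 * g t * (2 * Real.exp (-N) * φ t)) := by gcongr
      _ = _ := by ring
  rw [Real.dist_eq, abs_lt]
  constructor <;> linarith

theorem deHaan_auxiliary_choice_and_mean_tendsto_one
    (φ : ℝ → ℝ) (hφpos : ∀ t, 0 < φ t) (hφmono : Monotone φ)
    (hφint : IntegrableOn φ (Set.Iic (0:ℝ)))
    (h₀ : ℝ → ℝ) (h₀pos : ∀ t, 0 < h₀ t)
    (hΓ : ∀ u : ℝ, Tendsto (fun t => φ (t - u * h₀ t) / φ t) atTop (nhds (Real.exp (-u))))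
    (h₀inf : Tendsto h₀ atTop atTop)
    (h : ℝ → ℝ) (hh : ∀ t, h t = (∫ y in (0:ℝ)..t, φ y) / φ t) :
    (∀ u : ℝ, Tendsto (fun t => φ (t - u * h t) / φ t) atTop (nhds (Real.exp (-u)))) ∧
    Tendsto h atTop atTop ∧
    Tendsto (fun t => ∫ y in Set.Ioi (0:ℝ), φ (t - y * h t) / φ t) atTop (nhds 1) := by
  have htop := dh_phi_top φ hφpos hφmono h₀ h₀pos hΓ
  have hq : Tendsto (fun t => h t / h₀ t) atTop (nhds 1) := by
    refine (dh_q φ hφpos hφmono h₀ h₀pos hΓ h₀inf htop).congr (fun t => ?_)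
    rw [hh, div_div, mul_comm]
  have hinf : Tendsto h atTop atTop := by
    refine (hq.pos_mul_atTop one_pos h₀inf).congr (fun t => ?_)
    have := (h₀pos t).ne'
    field_simp
  refine ⟨fun u => ?_, hinf, ?_⟩
  · have hu : Tendsto (fun t => u * (h t / h₀ t)) atTop (nhds u) := by
      simpa using hq.const_mul u
    have hc : Continuous (fun v : ℝ => Real.exp (-v)) := by fun_prop
    rw [tendsto_order]
    constructor
    · intro a ha
      obtain ⟨v, hv, hav⟩ : ∃ v, u < v ∧ a < Real.exp (-v) := by
        have := (hc.tendsto u).eventually_const_lt ha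
        obtain ⟨v, hv1, hv2⟩ := ((this.filter_mono nhdsWithin_le_nhds).and
          (self_mem_nhdsWithin (s := Set.Ioi u))).exists
        exact ⟨v, hv2, hv1⟩
      filter_upwards [hu.eventually_lt_const hv, (hΓ v).eventually_const_lt hav] with t h1 h2
      refine h2.trans_le ?_
      rw [← mul_div_assoc, div_lt_iff₀ (h₀pos t)] at h1
      exact div_le_div_of_nonneg_right (hφmono (by linarith)) (hφpos t).le
    · intro a ha
      obtain ⟨v, hv, hav⟩ : ∃ v, v < u ∧ Real.exp (-v) < a := by
        have := (hc.tendsto u).eventually_lt_const ha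
        obtain ⟨v, hv1, hv2⟩ := ((this.filter_mono nhdsWithin_le_nhds).and
          (self_mem_nhdsWithin (s := Set.Iio u))).exists
        exact ⟨v, hv2, hv1⟩
      filter_upwards [hu.eventually_const_lt hv, (hΓ v).eventually_lt_const hav] with t h1 h2
      refine lt_of_le_of_lt ?_ h2
      rw [← mul_div_assoc, lt_div_iff₀ (h₀pos t)] at h1
      exact div_le_div_of_nonneg_right (hφmono (by linarith)) (hφpos t).le
  · have hK : Tendsto (fun t => ∫ y in (0:ℝ)..t, φ y) atTop atTop := by
      refine (hinf.atTop_mul_atTop₀ htop).congr (fun t => ?_)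
      rw [hh, div_mul_cancel₀ _ (hφpos t).ne']
    have hlim : Tendsto (fun t => 1 + (∫ y in Set.Iic (0:ℝ), φ y) / ∫ y in (0:ℝ)..t, φ y)
        atTop (nhds 1) := by
      simpa using (hK.const_div_atTop (∫ y in Set.Iic (0:ℝ), φ y)).const_add 1
    refine hlim.congr' ?_
    filter_upwards [hK.eventually_gt_atTop 0, eventually_ge_atTop 0] with t hKt ht
    have hht : 0 < h t := by rw [hh]; exact div_pos hKt (hφpos t)
    rw [integral_div, integral_comp_mul_right_Ioi (fun y => φ (t - y)) 0 hht, zero_mul]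
    have e1 : (∫ y in Set.Ioi (0:ℝ), φ (t - y)) = ∫ y in Set.Iio t, φ y := by
      have := (Measure.measurePreserving_sub_left (volume : Measure ℝ) t).setIntegral_preimage_emb
        (MeasurableEquiv.subLeft t).measurableEmbedding φ (Set.Iio t)
      rw [← this]
      congr 2
      ext x; simp
    have hint : IntegrableOn φ (Set.Iic t) := by
      rw [← Set.Iic_union_Ioc_eq_Iic ht]
      exact hφint.union (hφmono.intervalIntegrable (μ := volume) (a := 0) (b := t)).1
    have e2 := intervalIntegral.integral_Iic_sub_Iic hφint hint
    rw [e1, ← integral_Iic_eq_integral_Iio, smul_eq_mul]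
    have e3 : (∫ y in Set.Iic t, φ y) = (∫ y in (0:ℝ)..t, φ y) + ∫ y in Set.Iic (0:ℝ), φ y := by
      linarith
    rw [e3, hh]
    have := hφpos t
    field_simp
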